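/- arXiv:1511.01346 — 5 statements merged into one kernel-verified Lean document; each statement's English description precedes it below -/
import Mathlib

section
/- Let β > 0, let (ρ₁, K₁) and (ρ₂, K₂) be two material states with ρ₁, ρ₂, K₁, K₂ > 0, and let (ε, q) be a state with 1 + 4βσ(ε, K₁) ≥ 0. Define the mapped state δu = (δε, δq) by δq := ρ₂ q / ρ₁ and δε := (√(1 + 4βσ(ε, K₁)) − 1)/(2βK₂). Then the flux is exactly equalized: f(δε, δq; ρ₂, K₂) = f(ε, q; ρ₁, K₁), i.e., both −δq/ρ₂ = −q/ρ₁ and −σ(δε, K₂) = −σ(ε, K₁) hold (the δ-mapping for the elastic wave system is always solvable with γ = 1). -/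
/-- **The δ-mapping for the elastic wave system equalizes the flux (γ = 1 always works).**
Elastic flux `f(ε, q; ρ, K) = (−q/ρ, −σ(ε, K))` with `σ(ε, K) = K ε + β K² ε²`.
Given two material states `(ρ₁, K₁)`, `(ρ₂, K₂)` and a state `(ε, q)` with
`1 + 4βσ(ε, K₁) ≥ 0`, the mapped state `δq = ρ₂ q / ρ₁`,
`δε = (√(1 + 4βσ(ε, K₁)) − 1)/(2βK₂)` satisfies
`−δq/ρ₂ = −q/ρ₁` and `−σ(δε, K₂) = −σ(ε, K₁)`. -/
theorem delta_mapping_elastic_flux_equalized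
    (β ρ₁ ρ₂ K₁ K₂ ε q : ℝ)
    (hβ : 0 < β) (hρ₁ : 0 < ρ₁) (hρ₂ : 0 < ρ₂) (hK₁ : 0 < K₁) (hK₂ : 0 < K₂)
    (hnonneg : 1 + 4 * β * (K₁ * ε + β * K₁ ^ 2 * ε ^ 2) ≥ 0)
    (δq δε : ℝ)
    (hδq : δq = ρ₂ * q / ρ₁)
    (hδε : δε = (Real.sqrt (1 + 4 * β * (K₁ * ε + β * K₁ ^ 2 * ε ^ 2)) - 1) / (2 * β * K₂)) :
    -δq / ρ₂ = -q / ρ₁ ∧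
    -(K₂ * δε + β * K₂ ^ 2 * δε ^ 2) = -(K₁ * ε + β * K₁ ^ 2 * ε ^ 2) := by
  have hs := Real.sq_sqrt hnonneg
  generalize K₁ * ε + β * K₁ ^ 2 * ε ^ 2 = σ at *
  generalize Real.sqrt (1 + 4 * β * σ) = s at *
  constructor
  · subst hδq
    field_simp
  · have h1 : 2 * β * K₂ * δε = s - 1 := by
      rw [hδε]
      field_simp
    have h2 : (4 * β) * (K₂ * δε + β * K₂ ^ 2 * δε ^ 2) = (4 * β) * σ := by
      linear_combination (2 * β * K₂ * δε + s + 1) * h1 + hs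
    have h3 := mul_left_cancel₀ (by positivity : (4 * β) ≠ 0) h2
    rw [h3]
end

section
/- For the multi-class traffic model, the determinant of the Jacobian matrix J(u) with entries J_{lk} = b_l v(ρ) δ_{lk} + b_l u_l v'(ρ)/a satisfies det J(u) = v(ρ)^{m−1} · (∏_{l=1}^m b_l) · (v(ρ) + ρ v'(ρ)), where ρ = (1/a)∑_k u_k. Since v(ρ) + ρv'(ρ) = v_f(1 − 2ρ/ρ_jam) = q'(ρ) is the derivative of the scalar flux q(ρ) = ρv(ρ), the sign of det J(u) equals the sign of q'(ρ) whenever 0 ≤ ρ < ρ_jam. -/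
open Finset

theorem det_scalar_add_col (m : ℕ) (hm : 1 ≤ m) (x : ℝ) (w : Fin m → ℝ) :
    (Matrix.of fun l k : Fin m => x * (if l = k then 1 else 0) + w l).det
      = x ^ (m - 1) * (x + ∑ k, w k) := by
  rcases eq_or_ne x 0 with rfl | hx
  · rcases Nat.lt_or_ge 1 m with h | h
    · rw [zero_pow (by omega), zero_mul]
      refine Matrix.det_zero_of_column_eq (i := ⟨0, by omega⟩) (j := ⟨1, h⟩) ?_ ?_
      · simp
      · intro k
        simp
    · obtain rfl : m = 1 := by omega
      simp
  · have hM : (Matrix.of fun l k : Fin m => x * (if l = k then 1 else 0) + w l)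
        = x • (1 + Matrix.replicateCol Unit (fun l => w l / x)
            * Matrix.replicateRow Unit (fun _ => (1 : ℝ))) := by
      ext l k
      simp [Matrix.mul_apply, Matrix.one_apply]
      field_simp
      simp
    rw [hM, Matrix.det_smul, Matrix.det_one_add_replicateCol_mul_replicateRow]
    obtain ⟨n, rfl⟩ : ∃ n, m = n + 1 := ⟨m - 1, by omega⟩
    simp only [dotProduct, Fintype.card_fin, one_mul, ← Finset.sum_div, Nat.add_sub_cancel]
    field_simp
    ring

/-- **Determinant of the multi-class Jacobian.**
With `ρ = (∑ k, u k)/a`, `v(ρ) = v_f (1 − ρ/ρ_jam)`, `v'(ρ) = −v_f/ρ_jam`, the Jacobian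
`J l k = b_l v(ρ) δ_{lk} + b_l u_l v'(ρ)/a` satisfies
`det J = v(ρ)^(m−1) (∏ l, b_l) (v(ρ) + ρ v'(ρ))`; since
`v(ρ) + ρ v'(ρ) = v_f (1 − 2ρ/ρ_jam) = q'(ρ)`, the sign of `det J` equals the sign of
`q'(ρ)` whenever `0 ≤ ρ < ρ_jam`. -/
theorem multiclass_jacobian_det
    (m : ℕ) (hm : 1 ≤ m) (a v_f ρ_jam : ℝ) (ha : 0 < a) (hvf : 0 < v_f)
    (hρjam : 0 < ρ_jam) (b : Fin m → ℝ) (hb : ∀ l, 0 < b l) (hbmono : StrictMono b)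
    (u : Fin m → ℝ) (ρ : ℝ) (hρ : ρ = (∑ k, u k) / a)
    (J : Matrix (Fin m) (Fin m) ℝ)
    (hJ : ∀ l k, J l k = b l * (v_f * (1 - ρ / ρ_jam)) * (if l = k then 1 else 0)
        + b l * u l * (-v_f / ρ_jam) / a) :
    J.det = (v_f * (1 - ρ / ρ_jam)) ^ (m - 1) * (∏ l, b l)
        * (v_f * (1 - ρ / ρ_jam) + ρ * (-v_f / ρ_jam)) ∧
    (v_f * (1 - ρ / ρ_jam) + ρ * (-v_f / ρ_jam) = v_f * (1 - 2 * ρ / ρ_jam)) ∧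
    (0 ≤ ρ → ρ < ρ_jam → Real.sign J.det = Real.sign (v_f * (1 - 2 * ρ / ρ_jam))) := by
  have h2 : v_f * (1 - ρ / ρ_jam) + ρ * (-v_f / ρ_jam) = v_f * (1 - 2 * ρ / ρ_jam) := by
    ring
  have h1 : J.det = (v_f * (1 - ρ / ρ_jam)) ^ (m - 1) * (∏ l, b l)
        * (v_f * (1 - ρ / ρ_jam) + ρ * (-v_f / ρ_jam)) := by
    have hM : J = Matrix.of fun l k => b l * (Matrix.of fun l k : Fin m =>
        (v_f * (1 - ρ / ρ_jam)) * (if l = k then 1 else 0)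
          + u l * ((-v_f / ρ_jam) / a)) l k := by
      ext l k
      rw [hJ, Matrix.of_apply, Matrix.of_apply]
      ring
    have hs : ∑ k, u k * ((-v_f / ρ_jam) / a) = ρ * (-v_f / ρ_jam) := by
      rw [← Finset.sum_mul, hρ]
      ring
    rw [hM, Matrix.det_mul_column, det_scalar_add_col m hm, hs]
    ring
  refine ⟨h1, h2, fun _ hlt => ?_⟩
  rw [h1, h2]
  have hv : 0 < v_f * (1 - ρ / ρ_jam) :=
    mul_pos hvf (sub_pos.2 ((div_lt_one hρjam).2 hlt))
  have hc : 0 < (v_f * (1 - ρ / ρ_jam)) ^ (m - 1) * (∏ l, b l) :=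
    mul_pos (pow_pos hv _) (Finset.prod_pos fun l _ => hb l)
  generalize (v_f * (1 - ρ / ρ_jam)) ^ (m - 1) * (∏ l, b l) = c at hc
  generalize v_f * (1 - 2 * ρ / ρ_jam) = y
  rcases lt_trichotomy y 0 with h | rfl | h
  · rw [Real.sign_of_neg h, Real.sign_of_neg (mul_neg_of_pos_of_neg hc h)]
  · simp
  · rw [Real.sign_of_pos h, Real.sign_of_pos (mul_pos hc h)]
end

section
/- For the multi-class traffic model, the characteristic polynomial of the Jacobian matrix J(u) with entries J_{lk} = b_l v(ρ) δ_{lk} + b_l u_l v'(ρ)/a satisfies, for all real λ, det(λI − J(u)) = ∏_{l=1}^m (λ − b_l v(ρ)) − (v'(ρ)/a) ∑_{k=1}^m b_k u_k ∏_{l≠k} (λ − b_l v(ρ)), where ρ = (1/a)∑_k u_k. -/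
open Finset

theorem aux_det_ne {m : ℕ} (d c : Fin m → ℝ) (hd : ∀ i, d i ≠ 0) :
    (Matrix.diagonal d + Matrix.of (fun i _ => c i)).det
      = (∏ l, d l) + ∑ k, c k * ∏ l ∈ Finset.univ.erase k, d l := by
  have h1 : Matrix.diagonal d + Matrix.of (fun i _ => c i)
      = Matrix.diagonal d * (1 + Matrix.replicateCol Unit (fun i => c i / d i)
          * Matrix.replicateRow Unit (fun _ : Fin m => (1 : ℝ))) := by
    ext i j
    have := hd i
    rw [Matrix.diagonal_mul]
    simp only [Matrix.add_apply, Matrix.mul_apply, Matrix.of_apply, Matrix.replicateCol_apply,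
      Matrix.replicateRow_apply, Matrix.diagonal_apply, Matrix.one_apply]
    split_ifs <;> simp <;> field_simp
  rw [h1, Matrix.det_mul, Matrix.det_one_add_replicateCol_mul_replicateRow, Matrix.det_diagonal,
    mul_add, mul_one, dotProduct, Finset.mul_sum]
  congr 1
  refine Finset.sum_congr rfl fun k _ => ?_
  rw [← Finset.mul_prod_erase Finset.univ d (Finset.mem_univ k)]
  have := hd k
  field_simp

theorem aux_det {m : ℕ} (d c : Fin m → ℝ) :
    (Matrix.diagonal d + Matrix.of (fun i _ => c i)).det
      = (∏ l, d l) + ∑ k, c k * ∏ l ∈ Finset.univ.erase k, d l := by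
  have key : (fun t : ℝ => (Matrix.diagonal (fun i => d i + t) + Matrix.of (fun i _ => c i)).det)
      = fun t : ℝ => (∏ l, (d l + t)) + ∑ k, c k * ∏ l ∈ Finset.univ.erase k, (d l + t) := by
    refine Continuous.ext_on (s := (Set.range fun i => - d i)ᶜ)
      ((Set.finite_range _).countable.dense_compl ℝ) ?_ ?_ ?_
    · apply Continuous.matrix_det
      apply Continuous.add _ continuous_const
      apply Continuous.matrix_diagonal
      fun_prop
    · fun_prop
    · intro t ht
      refine aux_det_ne _ c fun i hi => ht ⟨i, ?_⟩
      simp only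
      linarith
  simpa using congrFun key 0

/-- **Characteristic polynomial of the multi-class Jacobian.**
With `ρ = (∑ k, u k)/a`, `v(ρ) = v_f (1 − ρ/ρ_jam)`, `v'(ρ) = −v_f/ρ_jam`, the Jacobian
`J l k = b_l v(ρ) δ_{lk} + b_l u_l v'(ρ)/a` satisfies, for all real `λ`,
`det (λI − J) = ∏ l, (λ − b_l v(ρ)) − (v'(ρ)/a) ∑ k, b_k u_k ∏_{l ≠ k} (λ − b_l v(ρ))`. -/
theorem multiclass_jacobian_charpoly_eval
    (m : ℕ) (hm : 1 ≤ m) (a v_f ρ_jam : ℝ) (ha : 0 < a) (hvf : 0 < v_f)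
    (hρjam : 0 < ρ_jam) (b : Fin m → ℝ) (hb : ∀ l, 0 < b l) (hbmono : StrictMono b)
    (u : Fin m → ℝ) (ρ : ℝ) (hρ : ρ = (∑ k, u k) / a)
    (J : Matrix (Fin m) (Fin m) ℝ)
    (hJ : ∀ l k, J l k = b l * (v_f * (1 - ρ / ρ_jam)) * (if l = k then 1 else 0)
        + b l * u l * (-v_f / ρ_jam) / a) :
    ∀ lam : ℝ,
      (lam • (1 : Matrix (Fin m) (Fin m) ℝ) - J).det
        = (∏ l, (lam - b l * (v_f * (1 - ρ / ρ_jam))))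
          - ((-v_f / ρ_jam) / a) * ∑ k, (b k * u k
              * ∏ l ∈ Finset.univ.erase k, (lam - b l * (v_f * (1 - ρ / ρ_jam)))) := by
  intro lam
  have h : lam • (1 : Matrix (Fin m) (Fin m) ℝ) - J
      = Matrix.diagonal (fun l => lam - b l * (v_f * (1 - ρ / ρ_jam)))
        + Matrix.of (fun l _ => -((-v_f / ρ_jam) / a) * (b l * u l)) := by
    ext i j
    simp only [Matrix.sub_apply, Matrix.add_apply, Matrix.smul_apply, Matrix.one_apply,
      Matrix.diagonal_apply, Matrix.of_apply, hJ, smul_eq_mul]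
    split_ifs <;> ring
  rw [h, aux_det, Finset.mul_sum, sub_eq_add_neg (∏ l, _), ← Finset.sum_neg_distrib]
  congr 1
  exact Finset.sum_congr rfl fun k _ => by ring
end

section
/- (Signs of the characteristic speeds.) Suppose u_l > 0 for all l = 1,...,m and 0 < ρ < ρ_jam, where ρ = (1/a)∑_k u_k, and let λ₁ < λ₂ < ... < λ_m be the m distinct real eigenvalues of the Jacobian J(u) of the multi-class flux. Then λ_l > 0 for every l ≥ 2, while the smallest eigenvalue changes sign at ρ* = ρ_jam/2: λ₁ > 0 if ρ < ρ_jam/2, λ₁ = 0 if ρ = ρ_jam/2, and λ₁ < 0 if ρ > ρ_jam/2. -/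
open Finset

/-- For `μ ≤ 0`, `μ` is an eigenvalue iff the secular function equals one. -/
lemma eig_iff_secular {m : ℕ} (hm : 0 < m) (V c : ℝ) (hV : 0 < V) (hc : 0 < c)
    (b u : Fin m → ℝ) (hb : ∀ l, 0 < b l) (hu : ∀ l, 0 < u l)
    (J : Matrix (Fin m) (Fin m) ℝ)
    (hJ : ∀ l k, J l k = b l * V * (if l = k then 1 else 0) - b l * u l * c)
    (μ : ℝ) (hμ : μ ≤ 0) :
    Module.End.HasEigenvalue (Matrix.toLin' J) μ ↔
      ∑ l, b l * u l * c / (b l * V - μ) = 1 := by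
  have hpos : ∀ l, 0 < b l * V - μ := fun l => by
    have := mul_pos (hb l) hV
    linarith
  have hmul : ∀ (x : Fin m → ℝ) l,
      Matrix.toLin' J x l = b l * V * x l - b l * u l * c * ∑ k, x k := by
    intro x l
    rw [Matrix.toLin'_apply]
    simp only [Matrix.mulVec, dotProduct, hJ, sub_mul, Finset.sum_sub_distrib, ← Finset.mul_sum]
    congr 1
    simp
  constructor
  · intro h
    obtain ⟨x, hx⟩ := h.exists_hasEigenvector
    have hxe := hx.apply_eq_smul
    have hx0 := hx.2
    have key : ∀ l, x l = b l * u l * c / (b l * V - μ) * ∑ k, x k := by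
      intro l
      have h1 := congrFun hxe l
      rw [hmul] at h1
      simp only [Pi.smul_apply, smul_eq_mul] at h1
      have := (hpos l).ne'
      field_simp
      linarith
    have hS : ∑ k, x k ≠ 0 := by
      intro h0
      apply hx0
      funext l
      rw [key l, h0]
      simp
    have h2 : ∑ k, x k = (∑ l, b l * u l * c / (b l * V - μ)) * ∑ k, x k := by
      rw [Finset.sum_mul]
      exact Finset.sum_congr rfl fun l _ => key l
    exact (mul_right_cancel₀ hS (by rw [one_mul]; exact h2)).symm
  · intro h
    apply Module.End.hasEigenvalue_of_hasEigenvector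
      (x := fun l => b l * u l * c / (b l * V - μ))
    refine Module.End.hasEigenvector_iff.mpr ⟨Module.End.mem_eigenspace_iff.mpr ?_, ?_⟩
    · funext l
      rw [hmul, h]
      simp only [Pi.smul_apply, smul_eq_mul]
      have := (hpos l).ne'
      field_simp
      ring
    · intro h0
      have h1 := congrFun h0 ⟨0, hm⟩
      have : 0 < b ⟨0, hm⟩ * u ⟨0, hm⟩ * c / (b ⟨0, hm⟩ * V - μ) :=
        div_pos (mul_pos (mul_pos (hb _) (hu _)) hc) (hpos _)
      simp only [Pi.zero_apply] at h1
      linarith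

/-- **Signs of the characteristic speeds of the multi-class system.**
Suppose `u l > 0` for all `l` and `0 < ρ < ρ_jam` where `ρ = (∑ k, u k)/a`, and let
`λ₁ < λ₂ < … < λ_m` be the `m` distinct real eigenvalues of the Jacobian `J` of the
multi-class flux.  Then `λ_l > 0` for every `l ≥ 2`, while the smallest eigenvalue
changes sign at `ρ* = ρ_jam/2`: `λ₁ > 0` if `ρ < ρ_jam/2`, `λ₁ = 0` if `ρ = ρ_jam/2`,
and `λ₁ < 0` if `ρ > ρ_jam/2`. -/
theorem multiclass_eigenvalue_signs
    (m : ℕ) (hm : 0 < m) (a v_f ρ_jam : ℝ) (ha : 0 < a) (hvf : 0 < v_f)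
    (hρjam : 0 < ρ_jam) (b : Fin m → ℝ) (hb : ∀ l, 0 < b l) (hbmono : StrictMono b)
    (u : Fin m → ℝ) (hu : ∀ l, 0 < u l)
    (ρ : ℝ) (hρ : ρ = (∑ k, u k) / a) (hρ0 : 0 < ρ) (hρjam' : ρ < ρ_jam)
    (J : Matrix (Fin m) (Fin m) ℝ)
    (hJ : ∀ l k, J l k = b l * (v_f * (1 - ρ / ρ_jam)) * (if l = k then 1 else 0)
        + b l * u l * (-v_f / ρ_jam) / a)
    (lam : Fin m → ℝ) (hmono : StrictMono lam)
    (heig : ∀ i, Module.End.HasEigenvalue (Matrix.toLin' J) (lam i))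
    (hall : ∀ μ : ℝ, Module.End.HasEigenvalue (Matrix.toLin' J) μ → ∃ i, μ = lam i) :
    (∀ i : Fin m, 0 < i.val → 0 < lam i) ∧
    (ρ < ρ_jam / 2 → 0 < lam ⟨0, hm⟩) ∧
    (ρ = ρ_jam / 2 → lam ⟨0, hm⟩ = 0) ∧
    (ρ > ρ_jam / 2 → lam ⟨0, hm⟩ < 0) := by
  have : NeZero m := ⟨hm.ne'⟩
  obtain ⟨V, hVdef⟩ : ∃ V, V = v_f * (1 - ρ / ρ_jam) := ⟨_, rfl⟩
  obtain ⟨c, hcdef⟩ : ∃ c, c = v_f / ρ_jam / a := ⟨_, rfl⟩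
  have hV : 0 < V := by
    rw [hVdef]
    have : ρ / ρ_jam < 1 := (div_lt_one hρjam).mpr hρjam'
    exact mul_pos hvf (by linarith)
  have hc : 0 < c := by rw [hcdef]; positivity
  have hJ' : ∀ l k, J l k = b l * V * (if l = k then 1 else 0) - b l * u l * c := by
    intro l k
    rw [hJ, hVdef, hcdef]
    ring
  have E := eig_iff_secular hm V c hV hc b u hb hu J hJ'
  have hpos : ∀ μ : ℝ, μ ≤ 0 → ∀ l, 0 < b l * V - μ := fun μ hμ l => by
    have := mul_pos (hb l) hV
    linarith
  have hn : ∀ l, 0 < b l * u l * c := fun l => mul_pos (mul_pos (hb l) (hu l)) hc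
  have hne : (Finset.univ : Finset (Fin m)).Nonempty := ⟨⟨0, hm⟩, Finset.mem_univ _⟩
  obtain ⟨g, hg⟩ : ∃ g : ℝ → ℝ, g = fun μ => ∑ l, b l * u l * c / (b l * V - μ) := ⟨_, rfl⟩
  have E' : ∀ μ ≤ 0, (Module.End.HasEigenvalue (Matrix.toLin' J) μ ↔ g μ = 1) := by
    intro μ hμ
    rw [E μ hμ, hg]
  have gmono : ∀ x y : ℝ, x < y → y ≤ 0 → g x < g y := by
    intro x y hxy hy
    rw [hg]
    refine Finset.sum_lt_sum_of_nonempty hne fun l _ => ?_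
    exact div_lt_div_of_pos_left (hn l) (hpos y hy l) (by linarith)
  have hg0 : g 0 * V = v_f * (ρ / ρ_jam) := by
    have h1 : g 0 = ∑ l, u l * (c / V) := by
      rw [hg]
      refine Finset.sum_congr rfl fun l _ => ?_
      have := (hb l).ne'
      rw [sub_zero]
      field_simp
    rw [h1, ← Finset.sum_mul, hρ, hcdef]
    field_simp
  have hr : ρ / ρ_jam * ρ_jam = ρ := div_mul_cancel₀ _ hρjam.ne'
  have hmin : ∀ i, lam ⟨0, hm⟩ ≤ lam i := fun i =>
    hmono.monotone (Fin.mk_le_of_le_val (Nat.zero_le _))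
  have hpos1 : ∀ i : Fin m, 0 < i.val → 0 < lam i := by
    intro i hi
    by_contra hcon
    have hcon := not_lt.mp hcon
    have h1 : lam ⟨0, hm⟩ < lam i := hmono (Fin.mk_lt_of_lt_val hi)
    have h2 := gmono _ _ h1 hcon
    rw [(E' _ hcon).mp (heig i), (E' _ (h1.le.trans hcon)).mp (heig _)] at h2
    exact lt_irrefl _ h2
  refine ⟨hpos1, ?_, ?_, ?_⟩
  · intro h
    by_contra hcon
    have hcon := not_lt.mp hcon
    have h1 := (E' _ hcon).mp (heig _)
    have h2 : g (lam ⟨0, hm⟩) ≤ g 0 := by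
      rcases hcon.lt_or_eq with h | h
      · exact (gmono _ _ h le_rfl).le
      · rw [h]
    have h3 : ρ / ρ_jam < 1 / 2 := by rw [div_lt_iff₀ hρjam]; linarith
    have h4 : V ≤ g 0 * V := le_mul_of_one_le_left hV.le (by linarith)
    rw [hg0, hVdef] at h4
    have := le_of_mul_le_mul_left h4 hvf
    linarith
  · intro h
    have h3 : ρ / ρ_jam = 1 / 2 := by rw [div_eq_iff hρjam.ne']; linarith
    have h4 : g 0 = 1 := by
      apply mul_right_cancel₀ hV.ne'
      rw [hg0, hVdef, h3]
      ring
    obtain ⟨i, hi⟩ := hall 0 ((E' 0 le_rfl).mpr h4)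
    rcases Nat.eq_zero_or_pos i.val with h0 | h0
    · have : i = ⟨0, hm⟩ := Fin.ext h0
      rw [← this, ← hi]
    · have := hpos1 i h0
      linarith
  · intro h
    have h3 : 1 / 2 < ρ / ρ_jam := by rw [lt_div_iff₀ hρjam]; linarith
    have h4 : 1 < g 0 := by
      have : 1 * V < g 0 * V := by
        rw [hg0, hVdef, one_mul]
        exact mul_lt_mul_of_pos_left (by linarith) hvf
      exact lt_of_mul_lt_mul_right this hV.le
    obtain ⟨M, hM⟩ : ∃ M, M = ∑ l, b l * u l * c := ⟨_, rfl⟩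
    have hM0 : 0 < M := by rw [hM]; exact Finset.sum_pos (fun l _ => hn l) hne
    have h5 : g (-M) ≤ 1 := by
      have : g (-M) ≤ ∑ l, b l * u l * c / M := by
        rw [hg]
        refine Finset.sum_le_sum fun l _ => ?_
        have := mul_pos (hb l) hV
        exact div_le_div_of_nonneg_left (hn l).le hM0 (by linarith)
      rwa [← Finset.sum_div, ← hM, div_self hM0.ne'] at this
    have hcont : ContinuousOn g (Set.Icc (-M) 0) := by
      rw [hg]
      refine continuousOn_finsetSum _ fun l _ => ?_
      refine ContinuousOn.div continuousOn_const (by fun_prop) ?_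
      intro x hx
      exact (hpos x hx.2 l).ne'
    obtain ⟨x, hx, hx1⟩ := intermediate_value_Icc (by linarith : -M ≤ 0) hcont ⟨h5, h4.le⟩
    have hx0 : x ≠ 0 := by
      rintro rfl
      linarith
    obtain ⟨i, hi⟩ := hall x ((E' x hx.2).mpr hx1)
    have := hmin i
    have := lt_of_le_of_ne hx.2 hx0
    linarith
end

section
/- (Existence and uniqueness of the δ-mapping for the multi-class model.) Let v_f > 0, ρ_jam > 0, v(s) = v_f(1 − s/ρ_jam), let m ≥ 1, α_l > 0 and ρ_l > 0 for l = 1,...,m with ρ := ∑_l ρ_l satisfying v(ρ) > 0, and set γ := min(1, (v_f ρ_jam/4)/(v(ρ) ∑_{l=1}^m α_l ρ_l)). Then there exists a unique vector (δρ_1, ..., δρ_m) of nonnegative reals such that δρ := ∑_{l=1}^m δρ_l ≤ ρ_jam/2 and δρ_l · v(δρ) = γ · α_l · ρ_l · v(ρ) for every l = 1,...,m. -/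
open Finset

/-- **Existence and uniqueness of the δ-mapping for the multi-class model.**
Let `v_f > 0`, `ρ_jam > 0`, `v(s) = v_f (1 − s/ρ_jam)`, `m ≥ 1`, `α_l > 0`, `ρ_l > 0`
with `ρ = ∑ l, ρ_l` satisfying `v(ρ) > 0`, and set
`γ = min (1, (v_f ρ_jam/4)/(v(ρ) ∑ l, α_l ρ_l))`.  Then there is a unique vector
`(δρ_1, …, δρ_m)` of nonnegative reals with `δρ = ∑ l, δρ_l ≤ ρ_jam/2` and
`δρ_l · v(δρ) = γ · α_l · ρ_l · v(ρ)` for every `l`. -/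
theorem delta_mapping_exists_unique
    (v_f ρ_jam : ℝ) (hvf : 0 < v_f) (hρjam : 0 < ρ_jam)
    (m : ℕ) (hm : 1 ≤ m) (α ρvec : Fin m → ℝ)
    (hα : ∀ l, 0 < α l) (hρvec : ∀ l, 0 < ρvec l)
    (ρ : ℝ) (hρ : ρ = ∑ l, ρvec l)
    (hv : 0 < v_f * (1 - ρ / ρ_jam))
    (γ : ℝ)
    (hγ : γ = min 1 ((v_f * ρ_jam / 4) / ((v_f * (1 - ρ / ρ_jam)) * ∑ l, α l * ρvec l))) :
    ∃! δρvec : Fin m → ℝ,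
      (∀ l, 0 ≤ δρvec l) ∧
      (∑ l, δρvec l) ≤ ρ_jam / 2 ∧
      ∀ l, δρvec l * (v_f * (1 - (∑ k, δρvec k) / ρ_jam))
          = γ * α l * ρvec l * (v_f * (1 - ρ / ρ_jam)) := by
  have : Nonempty (Fin m) := ⟨⟨0, hm⟩⟩
  have hS : 0 < ∑ l, α l * ρvec l :=
    Finset.sum_pos (fun l _ => mul_pos (hα l) (hρvec l)) Finset.univ_nonempty
  generalize v_f * (1 - ρ / ρ_jam) = V at *
  have hVS : 0 < V * ∑ l, α l * ρvec l := mul_pos hv hS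
  have hγ0 : 0 ≤ γ := by
    rw [hγ]
    exact le_min zero_le_one (by positivity)
  have hQ : γ * (V * ∑ l, α l * ρvec l) ≤ v_f * ρ_jam / 4 := by
    rw [← le_div_iff₀ hVS, hγ]
    exact min_le_right _ _
  have hsum : ∑ l, γ * α l * ρvec l * V = γ * (V * ∑ l, α l * ρvec l) := by
    rw [Finset.mul_sum, Finset.mul_sum]
    exact Finset.sum_congr rfl (fun l _ => by ring)
  have hpos : ∀ t : ℝ, t ≤ ρ_jam / 2 → 0 < v_f * (1 - t / ρ_jam) := by
    intro t ht
    apply mul_pos hvf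
    rw [sub_pos, div_lt_one hρjam]
    linarith
  obtain ⟨s, ⟨hs0, hs1⟩, hs⟩ : ∃ s ∈ Set.Icc 0 (ρ_jam / 2),
      s * (v_f * (1 - s / ρ_jam)) = γ * (V * ∑ l, α l * ρvec l) := by
    have hc : ContinuousOn (fun s : ℝ => s * (v_f * (1 - s / ρ_jam)))
        (Set.Icc 0 (ρ_jam / 2)) := by fun_prop
    apply intermediate_value_Icc (by positivity) hc
    refine ⟨by simpa using mul_nonneg hγ0 hVS.le, hQ.trans (le_of_eq ?_)⟩
    field_simp
    norm_num
  have hw := hpos s hs1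
  have hsd : ∑ l, γ * α l * ρvec l * V / (v_f * (1 - s / ρ_jam)) = s := by
    rw [← Finset.sum_div, hsum, ← hs]
    exact mul_div_cancel_right₀ _ hw.ne'
  refine ⟨fun l => γ * α l * ρvec l * V / (v_f * (1 - s / ρ_jam)), ⟨?_, ?_, ?_⟩, ?_⟩
  · intro l
    have := hα l
    have := hρvec l
    positivity
  · exact hsd.le.trans hs1
  · intro l
    simp only [hsd]
    exact div_mul_cancel₀ _ hw.ne'
  · rintro d ⟨_, hd1, hd⟩
    have hq : (∑ k, d k) * (v_f * (1 - (∑ k, d k) / ρ_jam)) = s * (v_f * (1 - s / ρ_jam)) := by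
      rw [hs, ← hsum, Finset.sum_mul]
      exact Finset.sum_congr rfl (fun l _ => hd l)
    have hds : ∑ k, d k = s := by
      generalize ∑ k, d k = t at *
      have h : (t - s) * (ρ_jam - t - s) = 0 := by
        field_simp at hq
        linarith
      rcases mul_eq_zero.mp h with h | h <;> linarith
    funext l
    have := hd l
    rw [hds] at this
    rw [← this]
    exact (mul_div_cancel_right₀ _ hw.ne').symm
end
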